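/- arXiv:2209.01656 — 3 statements merged into one kernel-verified Lean document; each statement's English description precedes it below -/
import Mathlib

section
/- Let t and k be positive integers. There exists n0 = n0(t,k) such that for all n ≥ n0 with n+t even, the following holds: for every cyclic permutation σ of [n], every integer m with 0 ≤ m ≤ k−1, and every t-intersecting k-Sperner family F ⊆ 2^[n] all of whose members have size between (n+t)/2 − m and (n+t)/2 + k − 1 + m, the subfamily F_σ of members of F that are intervals of σ satisfies Σ_{F ∈ F_σ} C(n,|F|) ≤ n · Σ_{i=0}^{k−1} C(n, (n+t)/2 + i). -/
open Finset

open scoped Classical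

/-- `F` is `t`-intersecting: every two members intersect in at least `t` elements. -/
def TIntersecting {n : ℕ} (t : ℕ) (F : Finset (Finset (Fin n))) : Prop :=
  ∀ A ∈ F, ∀ B ∈ F, t ≤ (A ∩ B).card

/-- `F` is `k`-Sperner: it contains no chain of `k+1` sets `A_0 ⊊ A_1 ⊊ … ⊊ A_k`. -/
def IsKSperner {n : ℕ} (k : ℕ) (F : Finset (Finset (Fin n))) : Prop :=
  ¬ ∃ c : Fin (k + 1) → Finset (Fin n),
      (∀ i, c i ∈ F) ∧ ∀ i j : Fin (k + 1), i < j → c i ⊂ c j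

/-- `σ` is a cyclic permutation of `[n]`: its cycle decomposition is a single `n`-cycle. -/
def IsCyclicPerm {n : ℕ} (σ : Equiv.Perm (Fin n)) : Prop :=
  σ.IsCycle ∧ σ.support = Finset.univ

/-- `F` is an interval of `σ`: `F = {x, σ x, …, σ^(ℓ-1) x}` for some `x`,
where `ℓ = |F|` satisfies `1 ≤ ℓ ≤ n - 1`. -/
def IsIntervalOf {n : ℕ} (σ : Equiv.Perm (Fin n)) (F : Finset (Fin n)) : Prop :=
  1 ≤ F.card ∧ F.card ≤ n - 1 ∧
    ∃ x : Fin n, F = (Finset.range F.card).image (fun i => (σ ^ i) x)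

/-- Binomial coefficients decrease beyond the middle. -/
theorem choose_le_choose_of_half_le {n a b : ℕ} (ha : n ≤ 2 * a) (hab : a ≤ b) :
    n.choose b ≤ n.choose a := by
  induction b, hab using Nat.le_induction with
  | base => exact le_rfl
  | succ b hab ih =>
    refine le_trans ?_ ih
    have h := Nat.choose_succ_right_eq n b
    have h2 : n.choose b * (n - b) ≤ n.choose b * (b + 1) := Nat.mul_le_mul_left _ (by omega)
    exact Nat.le_of_mul_le_mul_right (h ▸ h2) (Nat.succ_pos b)

/-- Forward difference of a row of binomial coefficients. -/
def chooseDiff (n x : ℕ) : ℤ := (n.choose (x + 1) : ℤ) - n.choose x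

/-- Binomial coefficients are concave within distance `√n / 2` of the middle. -/
theorem chooseDiff_succ_le {n x : ℕ} (hx : x + 1 ≤ n)
    (h : (2 * ((x : ℤ) + 1) - n) ^ 2 ≤ n) : chooseDiff n (x + 1) ≤ chooseDiff n x := by
  obtain ⟨y, rfl⟩ := Nat.exists_eq_add_of_le hx
  have h1 := Nat.choose_succ_right_eq (x + 1 + y) x
  have h2 := Nat.choose_succ_right_eq (x + 1 + y) (x + 1)
  rw [show x + 1 + y - x = y + 1 by omega] at h1
  rw [show x + 1 + y - (x + 1) = y by omega] at h2
  unfold chooseDiff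
  zify at h1 h2
  push_cast at h
  set a : ℤ := ((x + 1 + y).choose x : ℤ)
  set b : ℤ := ((x + 1 + y).choose (x + 1) : ℤ)
  set c : ℤ := ((x + 1 + y).choose (x + 1 + 1) : ℤ)
  have hb0 : 0 ≤ b := by positivity
  have hP : (0 : ℤ) < (x + 2) * (y + 1) := by positivity
  have key : (c + a) * ((x + 2) * (y + 1)) ≤ 2 * b * ((x + 2) * (y + 1)) := by
    have e : (c + a) * (((x : ℤ) + 2) * (y + 1)) =
        b * (y * (y + 1) + (x + 1) * (x + 2)) := by
      linear_combination (y + 1 : ℤ) * h2 - (x + 2 : ℤ) * h1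
    rw [e, mul_comm 2 b, mul_assoc]
    exact mul_le_mul_of_nonneg_left (by nlinarith) hb0
  linarith [le_of_mul_le_mul_right key hP]

theorem chooseDiff_le_of_le {n lo hi : ℕ} (hhi : hi ≤ n)
    (h : ∀ x, lo ≤ x → x < hi → (2 * ((x : ℤ) + 1) - n) ^ 2 ≤ n) {a b : ℕ}
    (ha : lo ≤ a) (hab : a ≤ b) (hb : b ≤ hi) : chooseDiff n b ≤ chooseDiff n a := by
  induction b, hab using Nat.le_induction with
  | base => exact le_rfl
  | succ b hab ih =>
    exact (chooseDiff_succ_le (by omega) (h b (by omega) (by omega))).trans (ih (by omega))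

/-- Midpoint concavity of binomial coefficients near the middle. -/
theorem choose_add_choose_le_two_mul {n lo hi : ℕ} (hhi : hi ≤ n)
    (h : ∀ x, lo ≤ x → x < hi → (2 * ((x : ℤ) + 1) - n) ^ 2 ≤ n) {c j : ℕ}
    (hlo : lo + j ≤ c) (hc : c + j ≤ hi) :
    (n.choose (c - j) : ℤ) + n.choose (c + j) ≤ 2 * n.choose c := by
  induction j with
  | zero => simp; linarith
  | succ j ih =>
    have h1 := ih (by omega) (by omega)
    have h2 := chooseDiff_le_of_le hhi h (a := c - (j + 1)) (b := c + j)
      (by omega) (by omega) (by omega)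
    unfold chooseDiff at h2
    rw [show c - (j + 1) + 1 = c - j by omega] at h2
    rw [← add_assoc]
    linarith

/-- If the `r`-th smallest element of a set bounded below by `b` has weight at most `u r`,
then the total weight is at most the sum of the `u r`. -/
theorem sum_le_sum_range_of_card_le (w u : ℕ → ℤ) (b k : ℕ) (L : Finset ℕ)
    (hcard : L.card ≤ k) (hb : ∀ a ∈ L, b ≤ a) (hu : ∀ r < k, 0 ≤ u r)
    (hw : ∀ a ∈ L, ∀ r < k, b + r ≤ a → w a ≤ u r) :
    ∑ a ∈ L, w a ≤ ∑ r ∈ range k, u r := by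
  induction k generalizing L with
  | zero => simp [Finset.card_eq_zero.mp (Nat.le_zero.mp hcard)]
  | succ k ih =>
    rw [sum_range_succ]
    rcases Nat.lt_or_ge k L.card with hlt | hge
    · have hne : L.Nonempty := card_pos.mp (by omega)
      have hM := L.max'_mem hne
      have hsub : L ⊆ Finset.Icc b (L.max' hne) := fun a ha =>
        Finset.mem_Icc.mpr ⟨hb a ha, L.le_max' a ha⟩
      have hc := card_le_card hsub
      rw [Nat.card_Icc] at hc
      rw [← Finset.sum_erase_add L w hM]
      refine add_le_add (ih (L.erase _) ?_ ?_ (fun r hr => hu r (by omega)) ?_)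
        (hw _ hM k (by omega) (by omega))
      · rw [card_erase_of_mem hM]; omega
      · exact fun a ha => hb a (mem_of_mem_erase ha)
      · exact fun a ha r hr => hw a (mem_of_mem_erase ha) r (by omega)
    · have := ih L hge hb (fun r hr => hu r (by omega)) (fun a ha r hr => hw a ha r (by omega))
      linarith [hu k (by omega)]

/-- The points `σ ^ i x` with `p ≤ i < q`. -/
noncomputable def cycleArc {n : ℕ} (σ : Equiv.Perm (Fin n)) (x : Fin n) (p q : ℤ) :
    Finset (Fin n) :=
  (Finset.Ico p q).image fun i => (σ ^ i) x

theorem cycleArc_subset {n : ℕ} (σ : Equiv.Perm (Fin n)) (x : Fin n) {p q p' q' : ℤ}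
    (hp : p' ≤ p) (hq : q ≤ q') : cycleArc σ x p q ⊆ cycleArc σ x p' q' :=
  image_subset_image (Finset.Ico_subset_Ico hp hq)

theorem card_cycleArc_le {n : ℕ} (σ : Equiv.Perm (Fin n)) (x : Fin n) (p q : ℤ) :
    (cycleArc σ x p q).card ≤ (q - p).toNat :=
  card_image_le.trans (by simp)

theorem cycleArc_zpow_apply {n : ℕ} (σ : Equiv.Perm (Fin n)) (x : Fin n) (d p q : ℤ) :
    cycleArc σ ((σ ^ d) x) p q = cycleArc σ x (p + d) (q + d) := by
  ext z
  simp only [cycleArc, mem_image, Finset.mem_Ico]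
  constructor
  · rintro ⟨i, hi, rfl⟩
    exact ⟨i + d, by omega, by rw [zpow_add, Equiv.Perm.mul_apply]⟩
  · rintro ⟨i, hi, rfl⟩
    refine ⟨i - d, by omega, ?_⟩
    rw [← Equiv.Perm.mul_apply, ← zpow_add, sub_add_cancel]

theorem image_range_pow_eq_cycleArc {n : ℕ} (σ : Equiv.Perm (Fin n)) (x : Fin n) (l : ℕ) :
    (range l).image (fun i => (σ ^ i) x) = cycleArc σ x 0 l := by
  ext z
  simp only [cycleArc, mem_image, Finset.mem_Ico, mem_range]
  constructor
  · rintro ⟨i, hi, rfl⟩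
    exact ⟨i, by omega, by simp⟩
  · rintro ⟨i, hi, rfl⟩
    lift i to ℕ using hi.1
    exact ⟨i, by omega, by simp⟩

/-- Two arcs read off within one turn of the cycle meet only where their ranges do. -/
theorem cycleArc_inter_subset {n : ℕ} {σ : Equiv.Perm (Fin n)} (hσ : IsCyclicPerm σ) (x : Fin n)
    {p q p' q' : ℤ} (hp : 0 ≤ p) (hq : q ≤ n) (hp' : 0 ≤ p') (hq' : q' ≤ n) :
    cycleArc σ x p q ∩ cycleArc σ x p' q' ⊆ cycleArc σ x (max p p') (min q q') := by
  intro z hz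
  simp only [cycleArc, mem_inter, mem_image, Finset.mem_Ico] at hz ⊢
  obtain ⟨⟨i, hi, rfl⟩, j, hj, hij⟩ := hz
  lift i to ℕ using by omega
  lift j to ℕ using by omega
  have hc := hσ.1.isCycleOn
  have hx : x ∈ σ.support := by rw [hσ.2]; exact mem_univ x
  simp only [zpow_natCast] at hij
  have hmod : j ≡ i [MOD n] := by
    have hc' : σ.IsCycleOn (σ.support : Set (Fin n)) := by
      simpa [Equiv.Perm.coe_support_eq_set_support] using hc
    have := (hc'.pow_apply_eq_pow_apply hx).mp hij
    rwa [hσ.2, card_univ, Fintype.card_fin] at this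
  have : j = i := Nat.ModEq.eq_of_lt_of_lt hmod (by omega) (by omega)
  subst this
  exact ⟨j, by omega, rfl⟩

/-- Chain of intervals: it grows to the right up to length `s`, and then to the left. -/
noncomputable def bentArc {n : ℕ} (σ : Equiv.Perm (Fin n)) (s : ℕ) (x : Fin n) (l : ℕ) :
    Finset (Fin n) :=
  cycleArc σ x (-((l - s : ℕ) : ℤ)) (min l s : ℕ)

theorem bentArc_mono {n : ℕ} (σ : Equiv.Perm (Fin n)) (s : ℕ) (x : Fin n) :
    Monotone (bentArc σ s x) := fun _ _ h => cycleArc_subset σ x (by omega) (by omega)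

theorem exists_eq_bentArc {n : ℕ} {σ : Equiv.Perm (Fin n)} (s : ℕ) {A : Finset (Fin n)}
    (hA : IsIntervalOf σ A) : ∃ x, A = bentArc σ s x A.card := by
  obtain ⟨-, -, z, hz⟩ := hA
  refine ⟨(σ ^ ((A.card - s : ℕ) : ℤ)) z, ?_⟩
  rw [bentArc, cycleArc_zpow_apply]
  rw [image_range_pow_eq_cycleArc] at hz
  convert hz using 2 <;> omega

/-- An interval of length `s - j` meets the interval of length `s + j - 1` in the opposite chain
in fewer than `t` points. -/
theorem card_bentArc_inter_lt {n s t : ℕ} {σ : Equiv.Perm (Fin n)} (hσ : IsCyclicPerm σ)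
    (hs : 2 * s = n + t) (ht : 0 < t) (x : Fin n) {j a b : ℕ} (hj : 0 < j) (hjs : t + j ≤ s)
    (ha : a = s - j) (hb : b < s + j) :
    (bentArc σ s x a ∩ bentArc σ s ((σ ^ ((s : ℤ) - t)) x) b).card < t := by
  have hsub : bentArc σ s x a ∩ bentArc σ s ((σ ^ ((s : ℤ) - t)) x) b ⊆
      cycleArc σ x (s - t - j + 1) (s - j) := by
    refine (inter_subset_inter (Finset.Subset.refl _)
      (bentArc_mono σ s _ (show b ≤ s + j - 1 by omega))).trans ?_
    unfold bentArc
    rw [cycleArc_zpow_apply]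
    refine (cycleArc_inter_subset hσ x ?_ ?_ ?_ ?_).trans (cycleArc_subset σ x ?_ ?_) <;> omega
  have h1 := (card_le_card hsub).trans (card_cycleArc_le σ x _ _)
  omega

/-- The lengths of the members of `F` in the chain through `x`. -/
noncomputable def chainLengths {n : ℕ} (σ : Equiv.Perm (Fin n)) (s : ℕ)
    (F : Finset (Finset (Fin n))) (x : Fin n) : Finset ℕ :=
  (F.filter fun A => A = bentArc σ s x A.card).image Finset.card

theorem bentArc_mem_of_mem_chainLengths {n : ℕ} {σ : Equiv.Perm (Fin n)} {s : ℕ}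
    {F : Finset (Finset (Fin n))} {x : Fin n} {l : ℕ} (h : l ∈ chainLengths σ s F x) :
    bentArc σ s x l ∈ F ∧ (bentArc σ s x l).card = l := by
  obtain ⟨A, hA, rfl⟩ := mem_image.mp h
  obtain ⟨hA, he⟩ := mem_filter.mp hA
  rw [← he]
  exact ⟨hA, rfl⟩

theorem card_chainLengths_le {n k : ℕ} (σ : Equiv.Perm (Fin n)) (s : ℕ)
    {F : Finset (Finset (Fin n))} (hF : IsKSperner k F) (x : Fin n) :
    (chainLengths σ s F x).card ≤ k := by
  by_contra! h
  refine hF ⟨fun i => bentArc σ s x ((chainLengths σ s F x).orderEmbOfCardLe h i), ?_, ?_⟩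
  · exact fun i => (bentArc_mem_of_mem_chainLengths (orderEmbOfCardLe_mem _ h i)).1
  · intro i j hij
    have hlt := ((chainLengths σ s F x).orderEmbOfCardLe h).strictMono hij
    refine (Finset.ssubset_iff_subset_ne).mpr ⟨bentArc_mono σ s x hlt.le, fun he => ?_⟩
    have := congrArg Finset.card he
    rw [(bentArc_mem_of_mem_chainLengths (orderEmbOfCardLe_mem _ h i)).2,
      (bentArc_mem_of_mem_chainLengths (orderEmbOfCardLe_mem _ h j)).2] at this
    omega

/-- The chains cover all intervals. -/
theorem sum_intervals_le_sum_chainLengths {n : ℕ} (σ : Equiv.Perm (Fin n)) (s : ℕ)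
    (F : Finset (Finset (Fin n))) (g : ℕ → ℕ) :
    ∑ A ∈ F.filter (fun A => IsIntervalOf σ A), g A.card ≤
      ∑ x, ∑ l ∈ chainLengths σ s F x, g l := by
  have hx (x : Fin n) : ∑ l ∈ chainLengths σ s F x, g l =
      ∑ A ∈ F, if A = bentArc σ s x A.card then g A.card else 0 := by
    rw [chainLengths, sum_image, sum_filter]
    intro A hA B hB hAB
    rw [(mem_filter.mp hA).2, (mem_filter.mp hB).2, hAB]
  simp_rw [hx]
  rw [sum_comm, sum_filter]
  refine sum_le_sum fun A _ => ?_
  split_ifs with hA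
  · obtain ⟨x, hx⟩ := exists_eq_bentArc s hA
    refine le_trans ?_ (single_le_sum (fun _ _ => Nat.zero_le _) (mem_univ x))
    rw [if_pos hx]
  · exact Nat.zero_le _

/-- For fixed positive `t, k` there is `n₀` such that for all `n ≥ n₀`
with `n + t` even, every cyclic permutation `σ` of `[n]`, every `0 ≤ m ≤ k-1`, and every
`t`-intersecting `k`-Sperner family `F` with member sizes between `(n+t)/2 - m` and
`(n+t)/2 + k - 1 + m`, the subfamily `F_σ` of intervals of `σ` satisfies
`∑_{F ∈ F_σ} C(n,|F|) ≤ n · ∑_{i=0}^{k-1} C(n, (n+t)/2 + i)`. -/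
theorem stmt_6 (t k : ℕ) (ht : 0 < t) (hk : 0 < k) :
    ∃ n₀ : ℕ, ∀ n : ℕ, n₀ ≤ n → Even (n + t) →
      ∀ σ : Equiv.Perm (Fin n), IsCyclicPerm σ →
      ∀ m : ℕ, m ≤ k - 1 →
      ∀ F : Finset (Finset (Fin n)), TIntersecting t F → IsKSperner k F →
        (∀ A ∈ F, ((n + t) / 2 : ℤ) - m ≤ A.card ∧
          (A.card : ℤ) ≤ ((n + t) / 2 : ℤ) + k - 1 + m) →
        ∑ A ∈ F.filter (fun A => IsIntervalOf σ A), n.choose A.card ≤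
          n * ∑ i ∈ Finset.range k, n.choose ((n + t) / 2 + i) := by
  refine ⟨(t + 4 * k + 4) ^ 2, fun n hn hev σ hσ m hm F hFt hFk hsize => ?_⟩
  obtain ⟨s, hs⟩ := hev
  have hdiv : (n + t) / 2 = s := by omega
  have hdivz : ((n : ℤ) + t) / 2 = s := by omega
  rw [hdivz] at hsize
  rw [hdiv]
  have hn' : 4 * (t + 4 * k + 4) ≤ n := by nlinarith
  have hconc : ∀ x, s - k ≤ x → x < s + 2 * k → (2 * ((x : ℤ) + 1) - n) ^ 2 ≤ n := by
    intro x h1 h2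
    have hsq : (2 * ((x : ℤ) + 1) - n) ^ 2 ≤ ((t : ℤ) + 4 * k + 4) ^ 2 :=
      sq_le_sq' (by omega) (by omega)
    exact hsq.trans (by exact_mod_cast hn)
  have hanti {a b : ℕ} (ha : s ≤ a) (hab : a ≤ b) : (n.choose b : ℤ) ≤ n.choose a :=
    Nat.cast_le.mpr (choose_le_choose_of_half_le (by omega) hab)
  set L : Fin n → Finset ℕ := chainLengths σ s F
  have hrange (x : Fin n) (l : ℕ) (hl : l ∈ L x) : s ≤ l + m ∧ l + 1 ≤ s + k + m := by
    obtain ⟨hmem, hcard⟩ := bentArc_mem_of_mem_chainLengths hl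
    have := hsize _ hmem
    rw [hcard] at this
    omega
  set J : Fin n → ℕ := fun x => (L x).sup fun l => s - l with hJ
  have hJle (x : Fin n) (l : ℕ) (hl : l ∈ L x) : s - l ≤ J x :=
    le_sup (f := fun l => s - l) hl
  have hJm (x : Fin n) : J x ≤ m := Finset.sup_le fun l hl => by have := hrange x l hl; omega
  set D : ℕ → ℤ := fun j => ∑ r ∈ range k, ((n.choose (s + r) : ℤ) - n.choose (s + r + j)) with hD
  set W : ℤ := ∑ r ∈ range k, (n.choose (s + r) : ℤ) with hW
  have hupper (x : Fin n) : ∑ l ∈ L x, (n.choose l : ℤ) ≤ W + D (J x) := by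
    rw [hW, hD, ← sum_add_distrib]
    refine sum_le_sum_range_of_card_le _ _ (s - J x) k (L x) (card_chainLengths_le σ s hFk x)
      (fun l hl => by have := hJle x l hl; omega) (fun r _ => ?_) (fun l hl r hr hle => ?_)
    · have := hanti (show s ≤ s + r by omega) (show s + r ≤ s + r + J x by omega)
      have h0 : (0 : ℤ) ≤ n.choose (s + r) := Nat.cast_nonneg _
      linarith
    · have hJx := hJm x
      rcases Nat.lt_or_ge l (s + r) with hlt | hge
      · obtain ⟨d, hd⟩ := Nat.exists_eq_add_of_lt hlt
        have h1 := choose_add_choose_le_two_mul (show s + 2 * k ≤ n by omega) hconc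
          (c := s + r) (j := d + 1) (by omega) (by omega)
        rw [show s + r - (d + 1) = l by omega] at h1
        have h2 := hanti (show s ≤ s + r + (d + 1) by omega)
          (show s + r + (d + 1) ≤ s + r + J x by omega)
        linarith
      · have h1 := hanti (show s ≤ s + r by omega) hge
        have h2 := hanti (show s ≤ s + r by omega) (show s + r ≤ s + r + J x by omega)
        linarith
  set φ : Equiv.Perm (Fin n) := σ ^ ((s : ℤ) - t) with hφ
  have hstep (x : Fin n) :
      ∑ l ∈ L (φ x), (n.choose l : ℤ) ≤ W + D (J (φ x)) - D (J x) := by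
    have hD0 : D 0 = 0 := by simp [hD]
    rcases Nat.eq_zero_or_pos (J x) with h0 | hpos
    · rw [h0, hD0, sub_zero]
      exact hupper (φ x)
    · have hne : (L x).Nonempty := by
        rw [nonempty_iff_ne_empty]
        intro h
        simp [hJ, h] at hpos
      obtain ⟨a, ha, haJ⟩ := exists_mem_eq_sup (L x) hne fun l => s - l
      change J x = s - a at haJ
      have hJx := hJm x
      have hge (b : ℕ) (hb : b ∈ L (φ x)) : s + J x ≤ b := by
        by_contra! hlt
        have h1 := card_bentArc_inter_lt hσ (show 2 * s = n + t by omega) ht x hpos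
          (by omega) (show a = s - J x by omega) hlt
        have h2 := hFt _ (bentArc_mem_of_mem_chainLengths ha).1 _
          (bentArc_mem_of_mem_chainLengths hb).1
        exact absurd h2 (not_le.mpr h1)
      have hJ0 : J (φ x) = 0 := by
        refine Nat.le_zero.mp (Finset.sup_le fun b hb => ?_)
        have := hge b hb
        omega
      rw [hJ0, hD0, add_zero, hW, hD, ← sum_sub_distrib]
      simp only [sub_sub_cancel]
      refine sum_le_sum_range_of_card_le _ _ (s + J x) k _ (card_chainLengths_le σ s hFk _)
        hge (fun r _ => Nat.cast_nonneg _) (fun l _ r _ hle => hanti (by omega) (by omega))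
  refine (sum_intervals_le_sum_chainLengths σ s F n.choose).trans ?_
  zify
  calc ∑ x, ∑ l ∈ L x, (n.choose l : ℤ)
      = ∑ x, ∑ l ∈ L (φ x), (n.choose l : ℤ) :=
        (Equiv.sum_comp φ fun x => ∑ l ∈ L x, (n.choose l : ℤ)).symm
    _ ≤ ∑ x, (W + D (J (φ x)) - D (J x)) := sum_le_sum fun x _ => hstep x
    _ = n * W := by
        rw [sum_sub_distrib, sum_add_distrib, Equiv.sum_comp φ fun x => D (J x)]
        simp
end

section
/- Let t and k be positive integers. There exists n0 = n0(t,k) such that for all n ≥ n0 with n+t even the following holds: if σ is a cyclic permutation of [n], m is an integer with 0 ≤ m ≤ k−1, and G is a full consecutive σ-k-Sperner t-intersecting family of intervals of σ with min{|G| : G ∈ G} = (n+t)/2 − m and max{|G| : G ∈ G} ≤ (n+t)/2 + k − 1 + m, then Σ_{G ∈ G} C(n,|G|) ≤ n · Σ_{i=0}^{k−1} C(n, (n+t)/2 + i). -/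
open Finset

/-- The chain `C_h`: the intervals of lengths `1, …, n-1` starting at `σ h`. -/
def chainAt {n : ℕ} (σ : Equiv.Perm (Fin n)) (h : Fin n) : Finset (Finset (Fin n)) :=
  (Finset.Icc 1 (n - 1)).image (fun ℓ => (Finset.range ℓ).image (fun i => (σ ^ i) (σ h)))

/-- `G` is a `σ`-`k`-Sperner `t`-intersecting family: a `t`-intersecting family of
intervals of `σ` meeting every chain `C_h` in at most `k` sets. -/
def SigmaKSpernerTIntersecting {n : ℕ} (σ : Equiv.Perm (Fin n)) (k t : ℕ)
    (G : Finset (Finset (Fin n))) : Prop :=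
  (∀ A ∈ G, IsIntervalOf σ A) ∧ TIntersecting t G ∧
    ∀ h : Fin n, (G ∩ chainAt σ h).card ≤ k

/-- `G` is consecutive: in every chain `C_h` the lengths of the members of `G ∩ C_h`
form a set of consecutive integers. -/
def ConsecutiveFam {n : ℕ} (σ : Equiv.Perm (Fin n)) (G : Finset (Finset (Fin n))) : Prop :=
  ∀ h : Fin n, ∃ a : ℕ,
    (G ∩ chainAt σ h).image Finset.card = Finset.Ico a (a + (G ∩ chainAt σ h).card)

/-- `G` is full consecutive: consecutive and meeting every chain `C_h` in exactly `k` sets. -/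
def FullConsecutive {n : ℕ} (σ : Equiv.Perm (Fin n)) (k : ℕ)
    (G : Finset (Finset (Fin n))) : Prop :=
  ConsecutiveFam σ G ∧ ∀ h : Fin n, (G ∩ chainAt σ h).card = k

theorem IsCyclicPerm.orderOf_eq {n : ℕ} {σ : Equiv.Perm (Fin n)} (hσ : IsCyclicPerm σ) :
    orderOf σ = n := by
  rw [hσ.1.orderOf, hσ.2, Finset.card_univ, Fintype.card_fin]

theorem IsCyclicPerm.pow_self {n : ℕ} {σ : Equiv.Perm (Fin n)} (hσ : IsCyclicPerm σ) :
    σ ^ n = 1 := by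
  simpa [hσ.orderOf_eq] using pow_orderOf_eq_one σ

theorem IsCyclicPerm.pow_apply_injOn {n : ℕ} {σ : Equiv.Perm (Fin n)} (hσ : IsCyclicPerm σ)
    (x : Fin n) : Set.InjOn (fun i : ℕ => (σ ^ i) x) (Set.Iio n) := by
  have key : ∀ i j : ℕ, j < n → i ≤ j → (σ ^ i) x = (σ ^ j) x → i = j := by
    intro i j hj hij h
    obtain ⟨d, rfl⟩ := Nat.exists_eq_add_of_le hij
    rw [pow_add, Equiv.Perm.mul_apply] at h
    have hd := (σ ^ i).injective h
    have hx : σ x ≠ x := by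
      rw [← Equiv.Perm.mem_support, hσ.2]
      exact Finset.mem_univ x
    have h1 := (hσ.1.pow_eq_one_iff' hx).2 hd.symm
    have h2 := orderOf_dvd_of_pow_eq_one h1
    rw [hσ.orderOf_eq] at h2
    have := Nat.eq_zero_of_dvd_of_lt h2 (by omega)
    omega
  intro i hi j hj h
  rcases le_total i j with hij | hij
  · exact key i j hj hij h
  · exact (key j i hi hij h.symm).symm

/-- A member of the chain at `h` is the interval of its own length starting at `σ h`. -/
theorem eq_interval_of_mem_chainAt {n : ℕ} {σ : Equiv.Perm (Fin n)} (hσ : IsCyclicPerm σ)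
    {h : Fin n} {A : Finset (Fin n)} (hA : A ∈ chainAt σ h) :
    A = (Finset.range A.card).image (fun i => (σ ^ i) (σ h)) := by
  obtain ⟨l, hl, rfl⟩ := Finset.mem_image.1 hA
  rw [Finset.mem_Icc] at hl
  rw [Finset.card_image_of_injOn, Finset.card_range]
  refine (hσ.pow_apply_injOn (σ h)).mono fun i hi => ?_
  have := Finset.mem_range.1 (Finset.mem_coe.1 hi)
  exact Set.mem_Iio.2 (by omega)

/-- Every interval of `σ` lies on some chain. -/
theorem IsIntervalOf.exists_mem_chainAt {n : ℕ} {σ : Equiv.Perm (Fin n)} {A : Finset (Fin n)}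
    (hA : IsIntervalOf σ A) : ∃ h, A ∈ chainAt σ h := by
  obtain ⟨h1, h2, x, hx⟩ := hA
  refine ⟨σ⁻¹ x, Finset.mem_image.2 ⟨A.card, Finset.mem_Icc.2 ⟨h1, h2⟩, ?_⟩⟩
  rw [← Equiv.Perm.mul_apply, mul_inv_cancel, Equiv.Perm.one_apply]
  exact hx.symm

/-- If the second interval starts after the end of the first one, their intersection is at most
the amount by which the second one wraps around. -/
theorem card_interval_inter_le {n : ℕ} {σ : Equiv.Perm (Fin n)} (hσ : IsCyclicPerm σ)
    (x : Fin n) {a b c : ℕ} (hac : a ≤ c) :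
    ((Finset.range a).image (fun i => (σ ^ i) x) ∩
      (Finset.range b).image (fun i => (σ ^ i) ((σ ^ c) x))).card ≤ c + b - n := by
  have hsub : (Finset.range a).image (fun i => (σ ^ i) x) ∩
      (Finset.range b).image (fun i => (σ ^ i) ((σ ^ c) x)) ⊆
      (Finset.Ico n (c + b)).image (fun i => (σ ^ i) x) := by
    intro y hy
    rw [Finset.mem_inter, Finset.mem_image, Finset.mem_image] at hy
    obtain ⟨⟨i, hi, rfl⟩, j, hj, hij⟩ := hy
    rw [Finset.mem_range] at hi hj
    rw [← Equiv.Perm.mul_apply, ← pow_add] at hij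
    refine Finset.mem_image.2 ⟨j + c, Finset.mem_Ico.2 ⟨?_, by omega⟩, hij⟩
    by_contra! hlt
    have := hσ.pow_apply_injOn x (Set.mem_Iio.2 hlt) (Set.mem_Iio.2 (by omega)) hij
    omega
  calc _ ≤ _ := Finset.card_le_card hsub
    _ ≤ _ := Finset.card_image_le
    _ = _ := Nat.card_Ico _ _

/-- The binomial coefficients are concave near the middle. -/
theorem choose_add_choose_add_two_le {n u : ℕ} (hu : u + 2 ≤ n)
    (h : (2 * (u + 1 : ℤ) - n) ^ 2 ≤ n + 2) :
    (n.choose u : ℤ) + n.choose (u + 2) ≤ 2 * n.choose (u + 1) := by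
  obtain ⟨w, rfl⟩ := Nat.exists_eq_add_of_le hu
  have h1 := Nat.choose_succ_right_eq (u + 2 + w) u
  have h2 := Nat.choose_succ_right_eq (u + 2 + w) (u + 1)
  rw [show u + 2 + w - u = w + 2 by omega] at h1
  rw [show u + 2 + w - (u + 1) = w + 1 by omega, show u + 1 + 1 = u + 2 by omega] at h2
  zify at h1 h2
  set X : ℤ := ((u + 2 + w).choose u : ℤ)
  set Y : ℤ := ((u + 2 + w).choose (u + 1) : ℤ)
  set Z : ℤ := ((u + 2 + w).choose (u + 2) : ℤ)
  have hY : 0 ≤ Y := Int.natCast_nonneg _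
  push_cast at h
  have hpos : (0 : ℤ) < (w + 2) * (u + 2) := by positivity
  refine le_of_mul_le_mul_left ?_ hpos
  have e : ((w : ℤ) + 2) * (u + 2) * (X + Z) =
      Y * ((u + 1) * (u + 2) + (w + 1) * (w + 2)) := by
    linear_combination (-((u : ℤ) + 2)) * h1 + ((w : ℤ) + 2) * h2
  rw [e]
  nlinarith [mul_nonneg hY (sub_nonneg.2 h)]

theorem choose_succ_le_choose {n u : ℕ} (hu : n ≤ 2 * u + 1) :
    n.choose (u + 1) ≤ n.choose u := by
  have h1 := Nat.choose_succ_right_eq n u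
  have h2 : n.choose u * (n - u) ≤ n.choose u * (u + 1) := Nat.mul_le_mul_left _ (by omega)
  exact Nat.le_of_mul_le_mul_right (h1 ▸ h2) (Nat.succ_pos u)

theorem choose_add_le_choose {n u : ℕ} (hu : n ≤ 2 * u + 1) (k : ℕ) :
    n.choose (u + k) ≤ n.choose u := by
  induction k with
  | zero => exact le_rfl
  | succ k ih => exact (choose_succ_le_choose (u := u + k) (by omega)).trans ih

/-- A sequence with nonpositive second differences has antitone increments. -/
theorem increment_le_of_concave {c : ℕ → ℤ} {q α : ℕ}
    (hc : ∀ u, q ≤ u → u + 1 ≤ q + α → c u + c (u + 2) ≤ 2 * c (u + 1)) :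
    c (q + α + 1) - c (q + α) ≤ c (q + 1) - c q := by
  induction α with
  | zero => exact le_rfl
  | succ α ih =>
    have h1 := ih fun u hu hu' => hc u hu (by omega)
    have h2 := hc (q + α) (by omega) (by omega)
    rw [show q + (α + 1) + 1 = q + α + 2 by omega, show q + (α + 1) = q + α + 1 by omega]
    linarith

theorem add_le_add_of_concave {c : ℕ → ℤ} {p α β : ℕ}
    (hc : ∀ u, p ≤ u → u + 2 ≤ p + α + β → c u + c (u + 2) ≤ 2 * c (u + 1)) :
    c p + c (p + α + β) ≤ c (p + α) + c (p + β) := by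
  induction β with
  | zero => simp [add_comm]
  | succ β ih =>
    have h1 := ih fun u hu hu' => hc u hu (by omega)
    have h2 := increment_le_of_concave (c := c) (q := p + β) (α := α)
      fun u hu hu' => hc u (by omega) (by omega)
    rw [show p + β + α = p + α + β by omega] at h2
    rw [← add_assoc, ← add_assoc]
    linarith

theorem sum_range_ite_sub {R : Type*} [AddCommGroup R] (g : ℕ → R) (p m : ℕ) :
    ∑ j ∈ Finset.range m, (if j < p then g (j + 1) - g j else 0) = g (min p m) - g 0 := by
  induction m with
  | zero => simp
  | succ m ih =>
    rw [Finset.sum_range_succ, ih]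
    split_ifs with h
    · rw [min_eq_right h.le, min_eq_right (Nat.succ_le_of_lt h)]
      abel
    · rw [min_eq_left (not_lt.1 h), min_eq_left (by omega), add_zero]

/-- If values below `s` are balanced by values above `s` at every level, and the gains of `F`
below `s` are dominated by its losses above `s`, then the sum of `F ∘ a` is at most what one
gets from the constant `s`. -/
theorem sum_comp_le_card_mul {ι : Type*} [Fintype ι] (a : ι → ℕ) (F : ℕ → ℤ) {s m : ℕ}
    (hlo : ∀ h, s - m ≤ a h) (hhi : ∀ h, a h ≤ s + m)
    (hcard : ∀ j < m, (Finset.univ.filter fun h => j < s - a h).card ≤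
      (Finset.univ.filter fun h => j < a h - s).card)
    (hanti : ∀ j < m, F (s + (j + 1)) ≤ F (s + j))
    (hconc : ∀ j < m, F (s - (j + 1)) - F (s - j) ≤ F (s + j) - F (s + (j + 1))) :
    ∑ h, F (a h) ≤ Fintype.card ι * F s := by
  have hF : ∀ h, F (a h) = F s + ∑ j ∈ Finset.range m,
      ((if j < s - a h then F (s - (j + 1)) - F (s - j) else 0) +
        (if j < a h - s then F (s + (j + 1)) - F (s + j) else 0)) := by
    intro h
    have h1 := hlo h
    have h2 := hhi h
    rw [Finset.sum_add_distrib, sum_range_ite_sub (fun j => F (s - j)),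
      sum_range_ite_sub (fun j => F (s + j)), min_eq_left (by omega), min_eq_left (by omega)]
    rcases le_total (a h) s with hs | hs
    · rw [Nat.sub_sub_self hs, Nat.sub_eq_zero_of_le hs]
      simp
    · rw [Nat.add_sub_cancel' hs, Nat.sub_eq_zero_of_le hs]
      simp
  rw [Finset.sum_congr rfl fun h _ => hF h, Finset.sum_add_distrib, Finset.sum_comm,
    Finset.sum_const, Finset.card_univ, nsmul_eq_mul]
  refine add_le_of_nonpos_right (Finset.sum_nonpos fun j hj => ?_)
  rw [Finset.mem_range] at hj
  rw [Finset.sum_add_distrib, ← Finset.sum_filter, ← Finset.sum_filter, Finset.sum_const,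
    Finset.sum_const, nsmul_eq_mul, nsmul_eq_mul]
  have h1 := hanti j hj
  have h2 := hconc j hj
  have h3 : ((Finset.univ.filter fun h => j < s - a h).card : ℤ) ≤
    (Finset.univ.filter fun h => j < a h - s).card := by exact_mod_cast hcard j hj
  nlinarith [mul_le_mul_of_nonneg_left h2
    (Int.natCast_nonneg (Finset.univ.filter fun h => j < s - a h).card)]

theorem sum_range_add_sub_succ (c : ℕ → ℤ) (k a : ℕ) :
    ∑ i ∈ Finset.range k, c (a + i) - ∑ i ∈ Finset.range k, c (a + 1 + i) =
      c a - c (a + k) := by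
  rw [← Finset.sum_sub_distrib, ← neg_inj, ← Finset.sum_neg_distrib, neg_sub]
  refine Eq.trans (Finset.sum_congr rfl fun i _ => ?_)
    (Finset.sum_range_sub (fun i => c (a + i)) k)
  rw [neg_sub, add_right_comm, add_assoc]

/-- For fixed positive `t, k` there is `n₀` such that for all `n ≥ n₀` with
`n + t` even: every full consecutive `σ`-`k`-Sperner `t`-intersecting family `G` with
minimum size `(n+t)/2 - m` (`0 ≤ m ≤ k-1`) and maximum size at most `(n+t)/2 + k - 1 + m`
satisfies `∑_{G} C(n,|G|) ≤ n · ∑_{i=0}^{k-1} C(n, (n+t)/2 + i)`. -/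
theorem stmt_8 (t k : ℕ) (ht : 0 < t) (hk : 0 < k) :
    ∃ n₀ : ℕ, ∀ n : ℕ, n₀ ≤ n → Even (n + t) →
      ∀ σ : Equiv.Perm (Fin n), IsCyclicPerm σ →
      ∀ m : ℕ, m ≤ k - 1 →
      ∀ G : Finset (Finset (Fin n)),
        SigmaKSpernerTIntersecting σ k t G → FullConsecutive σ k G →
        (∀ A ∈ G, (n + t) / 2 - m ≤ A.card) →
        (∃ A ∈ G, A.card = (n + t) / 2 - m) →
        (∀ A ∈ G, A.card ≤ (n + t) / 2 + k - 1 + m) →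
        ∑ A ∈ G, n.choose A.card ≤
          n * ∑ i ∈ Finset.range k, n.choose ((n + t) / 2 + i) := by
  refine ⟨(t + 4 * k + 4) ^ 2, fun n hn heven σ hσ m hm G hG hfull hlo _ hhi => ?_⟩
  obtain ⟨hint, htint, -⟩ := hG
  obtain ⟨hcons, hcard⟩ := hfull
  obtain ⟨s, hs⟩ : ∃ s, n + t = 2 * s := heven.two_dvd
  have hs2 : (n + t) / 2 = s := by omega
  rw [hs2] at hlo hhi ⊢
  have hnlarge : t + 4 * k + 4 ≤ n := by nlinarith
  choose a ha using hcons
  simp only [hcard] at ha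
  have hmem : ∀ h l, a h ≤ l → l < a h + k →
      (Finset.range l).image (fun i => (σ ^ i) (σ h)) ∈ G ∧
        ((Finset.range l).image (fun i => (σ ^ i) (σ h))).card = l := by
    intro h l hl hl'
    have hl2 : l ∈ (G ∩ chainAt σ h).image Finset.card := by
      rw [ha h]
      exact Finset.mem_Ico.2 ⟨hl, hl'⟩
    obtain ⟨A, hA, rfl⟩ := Finset.mem_image.1 hl2
    rw [Finset.mem_inter] at hA
    rw [← eq_interval_of_mem_chainAt hσ hA.2]
    exact ⟨hA.1, rfl⟩
  have halo : ∀ h, s - m ≤ a h := fun h => by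
    obtain ⟨h1, h2⟩ := hmem h (a h) le_rfl (by omega)
    exact h2 ▸ hlo _ h1
  have hahi : ∀ h, a h ≤ s + m := fun h => by
    obtain ⟨h1, h2⟩ := hmem h (a h + (k - 1)) (by omega) (by omega)
    have := hhi _ h1
    omega
  have hlevel : ∀ j < m, (Finset.univ.filter fun h => j < s - a h).card ≤
      (Finset.univ.filter fun h => j < a h - s).card := by
    intro j hj
    refine Finset.card_le_card_of_injOn (fun h => (σ ^ (s - (j + 1))) h) (fun h hh => ?_)
      (σ ^ (s - (j + 1))).injective.injOn
    simp only [Finset.coe_filter, Finset.mem_univ, true_and, Set.mem_ofPred_eq] at hh ⊢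
    by_contra! hlt
    have hinter := htint _ (hmem h (a h) le_rfl (by omega)).1
      _ (hmem ((σ ^ (s - (j + 1))) h) (a ((σ ^ (s - (j + 1))) h)) le_rfl (by omega)).1
    rw [← Equiv.Perm.mul_apply σ, (Commute.self_pow σ (s - (j + 1))).eq,
      Equiv.Perm.mul_apply] at hinter
    have hle := hinter.trans
      (card_interval_inter_le hσ (σ h) (by omega : a h ≤ s - (j + 1)))
    omega
  have hsum : ∀ h, ∑ A ∈ G ∩ chainAt σ h, n.choose A.card =
      ∑ i ∈ Finset.range k, n.choose (a h + i) := by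
    intro h
    have hinj : Set.InjOn Finset.card (↑(G ∩ chainAt σ h) : Set (Finset (Fin n))) := by
      rw [← Finset.card_image_iff, ha h, hcard h, Nat.card_Ico]
      omega
    rw [← Finset.sum_image (f := fun l => n.choose l) hinj, ha h, Finset.sum_Ico_eq_sum_range,
      Nat.add_sub_cancel_left]
  have hcover : ∑ A ∈ G, n.choose A.card ≤ ∑ h, ∑ A ∈ G ∩ chainAt σ h, n.choose A.card := by
    simp_rw [← Finset.filter_mem_eq_inter, Finset.sum_filter]
    rw [Finset.sum_comm]
    refine Finset.sum_le_sum fun A hA => ?_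
    obtain ⟨h, hh⟩ := (hint A hA).exists_mem_chainAt
    calc n.choose A.card = if A ∈ chainAt σ h then n.choose A.card else 0 := (if_pos hh).symm
      _ ≤ _ := Finset.single_le_sum
        (f := fun h => if A ∈ chainAt σ h then n.choose A.card else 0)
        (fun _ _ => Nat.zero_le _) (Finset.mem_univ h)
  refine hcover.trans ?_
  rw [Finset.sum_congr rfl fun h _ => hsum h]
  have hmain := sum_comp_le_card_mul a
    (fun l => ∑ i ∈ Finset.range k, (n.choose (l + i) : ℤ)) halo hahi hlevel ?_ ?_
  · rw [Fintype.card_fin] at hmain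
    exact_mod_cast hmain
  · intro j hj
    have h1 := sum_range_add_sub_succ (fun l => (n.choose l : ℤ)) k (s + j)
    have h2 : (n.choose (s + j + k) : ℤ) ≤ n.choose (s + j) := by
      exact_mod_cast choose_add_le_choose (by omega) k
    simp only [← add_assoc s j 1]
    linarith
  · intro j hj
    have h1 := sum_range_add_sub_succ (fun l => (n.choose l : ℤ)) k (s + j)
    have h2 := sum_range_add_sub_succ (fun l => (n.choose l : ℤ)) k (s - (j + 1))
    have h3 := add_le_add_of_concave (c := fun l => (n.choose l : ℤ)) (p := s - (j + 1))
      (α := 2 * j + 1) (β := k) fun u hu hu' => by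
        refine choose_add_choose_add_two_le (by omega) ?_
        have hl : -((t : ℤ) + 4 * k + 4) ≤ 2 * (u + 1 : ℤ) - n := by omega
        have hr : 2 * (u + 1 : ℤ) - n ≤ (t : ℤ) + 4 * k + 4 := by omega
        have hn' : ((t : ℤ) + 4 * k + 4) ^ 2 ≤ n := by exact_mod_cast hn
        nlinarith [sq_le_sq' hl hr]
    rw [show s - (j + 1) + 1 = s - j by omega] at h2
    rw [show s - (j + 1) + (2 * j + 1) = s + j by omega] at h3
    simp only [← add_assoc s j 1]
    linarith
end

section
/- Let t and k be positive integers. There exists n0 = n0(t,k) such that for all n ≥ n0 with n+t even the following holds: let σ be a cyclic permutation of [n], let m be an integer with 0 ≤ m < k, and let G be a full consecutive σ-k-Sperner t-intersecting family of intervals of σ with min{|G| : G ∈ G} = (n+t)/2 − m and max{|G| : G ∈ G} ≤ (n+t)/2 + k − 1 + m; let g_i be the number of intervals of G of length (n+t)/2 + i. Then Σ_{i=−(j+1)}^{j} g_i ≤ (j+1)·n − Σ_{i=k−j}^{m} g_{−i} for every integer j with 0 ≤ j ≤ m−1 and j ≥ k−m. -/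
open Finset

theorem IsCyclicPerm.pow_apply_injOn_s14 {n : ℕ} {σ : Equiv.Perm (Fin n)} (hσ : IsCyclicPerm σ)
    (x : Fin n) {a b : ℕ} (ha : a < n) (hb : b < n) (h : (σ ^ a) x = (σ ^ b) x) : a = b := by
  have hx : σ x ≠ x := Equiv.Perm.mem_support.1 (hσ.2 ▸ Finset.mem_univ x)
  have hpow : σ ^ a = σ ^ b := hσ.1.pow_eq_pow_iff.2 ⟨x, hx, h⟩
  rw [← hσ.orderOf_eq] at ha hb
  exact pow_injOn_Iio_orderOf ha hb hpow

/-- The arc of `σ` with `ℓ` steps starting at `x`. -/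
def arc {n : ℕ} (σ : Equiv.Perm (Fin n)) (x : Fin n) (ℓ : ℕ) : Finset (Fin n) :=
  (Finset.range ℓ).image (fun i => (σ ^ i) x)

theorem card_arc {n : ℕ} {σ : Equiv.Perm (Fin n)} (hσ : IsCyclicPerm σ) (x : Fin n) {ℓ : ℕ}
    (hℓ : ℓ ≤ n) : (arc σ x ℓ).card = ℓ := by
  rw [arc, Finset.card_image_of_injOn, Finset.card_range]
  intro a ha b hb h
  simp only [Finset.coe_range, Set.mem_Iio] at ha hb
  exact hσ.pow_apply_injOn_s14 x (by omega) (by omega) h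

/-- An arc and the arc starting right after its end overlap only by wrapping around. -/
theorem card_arc_inter_arc_le {n : ℕ} {σ : Equiv.Perm (Fin n)} (hσ : IsCyclicPerm σ) (x : Fin n)
    {a b : ℕ} : (arc σ x a ∩ arc σ ((σ ^ a) x) b).card ≤ a + b - n := by
  have hsub : arc σ x a ∩ arc σ ((σ ^ a) x) b ⊆
      (Finset.Ico n (a + b)).image (fun i => (σ ^ i) x) := by
    intro y hy
    simp only [arc, Finset.mem_inter, Finset.mem_image, Finset.mem_range, Finset.mem_Ico] at hy ⊢
    obtain ⟨⟨u, hu, rfl⟩, v, hv, h⟩ := hy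
    rw [← Equiv.Perm.mul_apply, ← pow_add] at h
    refine ⟨v + a, ⟨?_, by omega⟩, h⟩
    by_contra hlt
    have := hσ.pow_apply_injOn_s14 x (by omega) (by omega) h
    omega
  exact (Finset.card_le_card hsub).trans (Finset.card_image_le.trans (by simp))

theorem mem_chainAt_iff {n : ℕ} {σ : Equiv.Perm (Fin n)} (hσ : IsCyclicPerm σ) {h : Fin n}
    {S : Finset (Fin n)} :
    S ∈ chainAt σ h ↔ 1 ≤ S.card ∧ S.card ≤ n - 1 ∧ S = arc σ (σ h) S.card := by
  simp only [chainAt, Finset.mem_image, Finset.mem_Icc]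
  constructor
  · rintro ⟨ℓ, ⟨h1, h2⟩, rfl⟩
    have hc : ((Finset.range ℓ).image (fun i => (σ ^ i) (σ h))).card = ℓ :=
      card_arc hσ (σ h) (by omega)
    rw [hc]
    exact ⟨h1, h2, rfl⟩
  · rintro ⟨h1, h2, h3⟩
    exact ⟨S.card, ⟨h1, h2⟩, h3.symm⟩

/-- Levels in the window `[-(j+1), j]` plus levels in `[-m, j-k]`, for a run of `k` consecutive
levels starting at `b`. -/
theorem card_levels_le {k m j : ℕ} {b : ℤ} (hm : m < k) (hj : j + 1 ≤ m) (hb : -(m : ℤ) ≤ b) :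
    (((Finset.Icc (-(j : ℤ) - 1) j).filter (fun i => b ≤ i ∧ i < b + k)).card : ℤ) +
      (((Finset.Icc ((k : ℤ) - j) m).filter (fun i => b ≤ -i ∧ -i < b + k)).card : ℤ) ≤
    ((j : ℤ) + 1) + ((((Finset.Icc 1 (j + 1)).filter (fun s : ℕ => b ≤ -(s : ℤ))).card : ℤ) -
      (((Finset.Icc 1 (j + 1)).filter (fun s : ℕ => (s : ℤ) ≤ b)).card : ℤ)) := by
  have h1 : (Finset.Icc (-(j : ℤ) - 1) j).filter (fun i => b ≤ i ∧ i < b + k) =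
      Finset.Icc (max (-(j : ℤ) - 1) b) (min j (b + k - 1)) := by
    ext i; simp only [Finset.mem_filter, Finset.mem_Icc]; omega
  have h2 : (Finset.Icc ((k : ℤ) - j) m).filter (fun i => b ≤ -i ∧ -i < b + k) =
      Finset.Icc (k - j : ℤ) (-b) := by
    ext i; simp only [Finset.mem_filter, Finset.mem_Icc]; omega
  have h3 : (Finset.Icc 1 (j + 1)).filter (fun s : ℕ => b ≤ -(s : ℤ)) =
      Finset.Icc 1 (min (j + 1) (-b).toNat) := by
    ext i; simp only [Finset.mem_filter, Finset.mem_Icc]; omega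
  have h4 : (Finset.Icc 1 (j + 1)).filter (fun s : ℕ => (s : ℤ) ≤ b) =
      Finset.Icc 1 (min (j + 1) b.toNat) := by
    ext i; simp only [Finset.mem_filter, Finset.mem_Icc]; omega
  rw [h1, h2, h3, h4, Int.card_Icc, Int.card_Icc, Nat.card_Icc, Nat.card_Icc]
  omega

theorem sum_card_filter_comm {α β : Type*} (s : Finset α) (t : Finset β) (p : α → β → Prop)
    [∀ a b, Decidable (p a b)] :
    ∑ a ∈ s, ((t.filter (p a)).card : ℤ) = ∑ b ∈ t, ((s.filter (fun a => p a b)).card : ℤ) := by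
  exact_mod_cast Finset.sum_card_bipartiteAbove_eq_sum_card_bipartiteBelow p

/-- (Lemma on interval counts, inequality (2).)
`∑_{i=-(j+1)}^{j} g_i ≤ (j+1)n - ∑_{i=k-j}^{m} g_{-i}` for all `0 ≤ j ≤ m - 1` with
`j ≥ k - m`. -/
theorem stmt_14 (t k : ℕ) (ht : 0 < t) (hk : 0 < k) :
    ∃ n₀ : ℕ, ∀ n : ℕ, n₀ ≤ n → Even (n + t) →
      ∀ σ : Equiv.Perm (Fin n), IsCyclicPerm σ →
      ∀ m : ℕ, m < k →
      ∀ G : Finset (Finset (Fin n)),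
        SigmaKSpernerTIntersecting σ k t G → FullConsecutive σ k G →
        (∀ A ∈ G, ((n + t) / 2 : ℤ) - m ≤ A.card) →
        (∃ A ∈ G, (A.card : ℤ) = ((n + t) / 2 : ℤ) - m) →
        (∀ A ∈ G, (A.card : ℤ) ≤ ((n + t) / 2 : ℤ) + k - 1 + m) →
        ∀ (g : ℤ → ℕ)
    (hg : ∀ i : ℤ, g i = (G.filter (fun S => (S.card : ℤ) = ((n + t) / 2 : ℤ) + i)).card),
        ∀ j : ℕ, j + 1 ≤ m → k ≤ j + m →
          ∑ i ∈ Finset.Icc (-(j : ℤ) - 1) (j : ℤ), (g i : ℤ) ≤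
            ((j : ℤ) + 1) * n - ∑ i ∈ Finset.Icc ((k : ℤ) - j) (m : ℤ), (g (-i) : ℤ) := by
  refine ⟨0, fun n _ hpar σ hσ m hm G hG hfull hmin _ _ g hg j hj _ => ?_⟩
  obtain ⟨hint, htint, -⟩ := hG
  obtain ⟨hcons, hcard⟩ := hfull
  obtain ⟨c, hc⟩ : ∃ c : ℤ, ((n + t) / 2 : ℤ) = c := ⟨_, rfl⟩
  have hnt : (n : ℤ) + t = 2 * c := by
    obtain ⟨r, hr⟩ := hpar
    omega
  simp only [hc] at hmin hg
  choose a ha using hcons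
  simp only [hcard] at ha
  have hlev : ∀ h ℓ, a h ≤ ℓ → ℓ < a h + k → ℓ ≤ n ∧ arc σ (σ h) ℓ ∈ G := by
    intro h ℓ h1 h2
    have : ℓ ∈ (G ∩ chainAt σ h).image Finset.card := by
      rw [ha]; exact Finset.mem_Ico.2 ⟨h1, h2⟩
    obtain ⟨S, hS, rfl⟩ := Finset.mem_image.1 this
    obtain ⟨hSG, hSc⟩ := Finset.mem_inter.1 hS
    obtain ⟨-, h4, h5⟩ := (mem_chainAt_iff hσ).1 hSc
    exact ⟨by omega, h5 ▸ hSG⟩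
  have hbm : ∀ h, -(m : ℤ) ≤ a h - c := by
    intro h
    obtain ⟨h1, h2⟩ := hlev h (a h) le_rfl (by omega)
    have := hmin _ h2
    rw [card_arc hσ _ h1] at this
    omega
  have hgle : ∀ i : ℤ, (g i : ℤ) ≤
      ((univ : Finset (Fin n)).filter (fun h => (a h : ℤ) - c ≤ i ∧ i < a h - c + k)).card := by
    intro i
    rw [hg]
    have hsub : G.filter (fun S => (S.card : ℤ) = c + i) ⊆
        ((univ : Finset (Fin n)).filter (fun h => (a h : ℤ) - c ≤ i ∧ i < a h - c + k)).image
          (fun h => arc σ (σ h) (c + i).toNat) := by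
      intro S hS
      obtain ⟨hSG, hSi⟩ := Finset.mem_filter.1 hS
      obtain ⟨h1, h2, x, hx⟩ := hint S hSG
      have hS' : S = arc σ (σ (σ.symm x)) S.card := by
        rw [Equiv.apply_symm_apply]; exact hx
      have hmem : S.card ∈ (G ∩ chainAt σ (σ.symm x)).image Finset.card :=
        Finset.mem_image_of_mem _
          (Finset.mem_inter.2 ⟨hSG, (mem_chainAt_iff hσ).2 ⟨h1, h2, hS'⟩⟩)
      rw [ha, Finset.mem_Ico] at hmem
      refine Finset.mem_image.2 ⟨σ.symm x, ?_, ?_⟩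
      · simp only [Finset.mem_filter, Finset.mem_univ, true_and]
        omega
      · rw [← hSi, Int.toNat_natCast]
        exact hS'.symm
    exact_mod_cast (Finset.card_le_card hsub).trans Finset.card_image_le
  have hpair : ∀ s ∈ Finset.Icc 1 (j + 1),
      (((univ : Finset (Fin n)).filter (fun h => (a h : ℤ) - c ≤ -(s : ℤ))).card : ℤ) ≤
      ((univ : Finset (Fin n)).filter (fun h => (s : ℤ) ≤ (a h : ℤ) - c)).card := by
    intro s hs
    rw [Finset.mem_Icc] at hs
    have := Finset.card_le_card_of_injOn
      (s := (univ : Finset (Fin n)).filter (fun h => (a h : ℤ) - c ≤ -(s : ℤ)))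
      (t := (univ : Finset (Fin n)).filter (fun h => (s : ℤ) ≤ (a h : ℤ) - c))
      (fun h => (σ ^ (c - s).toNat) h) ?_ (Equiv.injective _).injOn
    · exact_mod_cast this
    intro h hh
    simp only [Finset.coe_filter, Finset.mem_univ, true_and, Set.mem_ofPred_eq] at hh ⊢
    have hb := hbm h
    obtain ⟨-, hA2⟩ := hlev h (c - s).toNat (by omega) (by omega)
    obtain ⟨hB1, hB2⟩ := hlev ((σ ^ (c - s).toNat) h) _ le_rfl (by omega)
    have hcomm : σ ((σ ^ (c - s).toNat) h) = (σ ^ (c - s).toNat) (σ h) := by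
      rw [← Equiv.Perm.mul_apply, ← Equiv.Perm.mul_apply, ← pow_succ', ← pow_succ]
    have h1 := htint _ hA2 _ hB2
    rw [hcomm] at h1
    have h2 := h1.trans (card_arc_inter_arc_le hσ (σ h))
    omega
  have hmain := Finset.sum_le_sum fun (h : Fin n) (_ : h ∈ univ) => card_levels_le hm hj (hbm h)
  simp only [Finset.sum_add_distrib, Finset.sum_sub_distrib] at hmain
  rw [sum_card_filter_comm univ _ (fun h i => (a h : ℤ) - c ≤ i ∧ i < (a h : ℤ) - c + k),
    sum_card_filter_comm univ _ (fun h i => (a h : ℤ) - c ≤ -i ∧ -i < (a h : ℤ) - c + k),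
    sum_card_filter_comm univ _ (fun h (s : ℕ) => (a h : ℤ) - c ≤ -(s : ℤ)),
    sum_card_filter_comm univ _ (fun h (s : ℕ) => (s : ℤ) ≤ (a h : ℤ) - c)] at hmain
  have e1 := Finset.sum_le_sum fun i (_ : i ∈ Finset.Icc (-(j : ℤ) - 1) (j : ℤ)) => hgle i
  have e2 := Finset.sum_le_sum fun i (_ : i ∈ Finset.Icc ((k : ℤ) - j) (m : ℤ)) => hgle (-i)
  have e3 := Finset.sum_le_sum hpair
  simp only [Finset.sum_const, Finset.card_univ, Fintype.card_fin, nsmul_eq_mul, mul_one]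
    at hmain
  linarith
end
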